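/- Let k ≥ 1, let F = GaloisField 2 (2k), let i ≥ 0 be an integer, and let t1, t2 be positive integers with t1 + t2 = k. Assume that the only z in the subfield F_{2^k} with z^{2^{t1}} + z^{2^{t2}} + z = 0 is z = 0. Then for α ∈ F, the Boolean function F_α^i(x) = Tr(α G(x)) with G(x) = x^{2^i} (x + x^{2^k} + x^{2^{t1}} + x^{2^{t1+k}} + x^{2^{t2}} + x^{2^{t2+k}}) is bent if and only if α^{2^k} ≠ α. -/

import Mathlib

open Finset

noncomputable instance (n : ℕ) : Fintype (GaloisField 2 n) := Fintype.ofFinite _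

/-- The absolute trace of `GaloisField 2 n` over `ZMod 2`. -/
noncomputable def gTr (n : ℕ) : GaloisField 2 n → ZMod 2 :=
  Algebra.trace (ZMod 2) (GaloisField 2 n)

/-- A Boolean function on `GaloisField 2 n` is bent if all its Walsh values
square to `2^n`. -/
def IsBent {n : ℕ} (f : GaloisField 2 n → ZMod 2) : Prop :=
  ∀ lam : GaloisField 2 n,
    (∑ x : GaloisField 2 n, (-1 : ℤ) ^ (f x + gTr n (lam * x)).val) ^ 2 = 2 ^ n
theorem neg_one_pow_val_add (a b : ZMod 2) :
    (-1 : ℤ) ^ (a + b).val = (-1) ^ a.val * (-1) ^ b.val := by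
  revert a b; decide

theorem sum_neg_one_pow_eq_zero_of_translate {V : Type*} [AddCommGroup V] [Fintype V]
    (g : V → ZMod 2) (u : V) (hu : ∀ x, g (x + u) = g x + 1) :
    ∑ x, (-1 : ℤ) ^ (g x).val = 0 := by
  have key : ∑ x, (-1 : ℤ) ^ (g x).val = -∑ x, (-1 : ℤ) ^ (g x).val := by
    calc ∑ x, (-1 : ℤ) ^ (g x).val = ∑ x, (-1 : ℤ) ^ (g (x + u)).val :=
          (Equiv.sum_comp (Equiv.addRight u) fun x => (-1 : ℤ) ^ (g x).val).symm
      _ = -∑ x, (-1 : ℤ) ^ (g x).val := by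
          rw [← sum_neg_distrib]
          refine sum_congr rfl fun x _ => ?_
          rw [hu, neg_one_pow_val_add]
          simp [ZMod.val_one]
  linarith

/-- If all nontrivial derivatives of `g` are balanced, its exponential sum squares to the
cardinality of the domain. -/
theorem sq_sum_neg_one_pow_eq_card {V : Type*} [AddCommGroup V] [Fintype V]
    (g : V → ZMod 2)
    (hg : ∀ u ≠ 0, ∑ x, (-1 : ℤ) ^ (g x + g (x + u)).val = 0) :
    (∑ x, (-1 : ℤ) ^ (g x).val) ^ 2 = Fintype.card V := by
  calc (∑ x, (-1 : ℤ) ^ (g x).val) ^ 2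
      = ∑ x, ∑ u, (-1 : ℤ) ^ (g x + g (x + u)).val := by
        rw [sq, sum_mul_sum]
        refine sum_congr rfl fun x _ => ?_
        simp only [neg_one_pow_val_add]
        exact (Equiv.sum_comp (Equiv.addLeft x)
          fun y => (-1 : ℤ) ^ (g x).val * (-1) ^ (g y).val).symm
    _ = ∑ u, ∑ x, (-1 : ℤ) ^ (g x + g (x + u)).val := sum_comm
    _ = ∑ x : V, (-1 : ℤ) ^ (g x + g (x + 0)).val := sum_eq_single_of_mem 0 (mem_univ _)
          fun u _ hu => hg u hu
    _ = Fintype.card V := by simp [CharTwo.add_self_eq_zero]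

section Trace

variable {n : ℕ}

theorem gTr_add (x y : GaloisField 2 n) : gTr n (x + y) = gTr n x + gTr n y :=
  map_add (Algebra.trace (ZMod 2) (GaloisField 2 n)) x y

theorem gTr_zero : gTr n 0 = 0 :=
  map_zero (Algebra.trace (ZMod 2) (GaloisField 2 n))

theorem gTr_pow_two_pow (x : GaloisField 2 n) (m : ℕ) : gTr n (x ^ 2 ^ m) = gTr n x := by
  induction m with
  | zero => simp
  | succ m ih =>
    rw [pow_succ, pow_mul, ← ih]
    have := Algebra.trace_eq_of_algEquiv
      (FiniteField.frobeniusAlgEquivOfAlgebraic (ZMod 2) (GaloisField 2 n)) (x ^ 2 ^ m)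
    simpa [gTr, ZMod.card] using this

theorem eq_zero_of_gTr_mul_eq_zero {a : GaloisField 2 n}
    (ha : ∀ x, gTr n (a * x) = 0) : a = 0 :=
  (traceForm_nondegenerate (ZMod 2) (GaloisField 2 n)).1 a ha

theorem add_pow_two_pow (x y : GaloisField 2 n) (m : ℕ) :
    (x + y) ^ 2 ^ m = x ^ 2 ^ m + y ^ 2 ^ m :=
  add_pow_char_pow x y 2 m

theorem pow_two_pow_self (hn : n ≠ 0) (x : GaloisField 2 n) : x ^ 2 ^ n = x := by
  have := FiniteField.pow_card x
  rwa [← Nat.card_eq_fintype_card, GaloisField.card 2 n hn] at this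

theorem exists_pow_two_pow_eq (x : GaloisField 2 n) (m : ℕ) : ∃ y, y ^ 2 ^ m = x :=
  (Finite.surjective_of_injective (iterateFrobenius (GaloisField 2 n) 2 m).injective) x

/-- Up to the trace, multiplication by `a` after a power of Frobenius is multiplication by
the inverse power of Frobenius applied to `a`. -/
theorem gTr_mul_pow_two_pow (hn : n ≠ 0) (a x : GaloisField 2 n) {j l : ℕ}
    (hjl : j + l = n) : gTr n (a * x ^ 2 ^ j) = gTr n (a ^ 2 ^ l * x) := by
  rw [← gTr_pow_two_pow _ l, mul_pow, ← pow_mul, ← pow_add, hjl, pow_two_pow_self hn]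

end Trace

/-- The linearized factor `x + x^{2^k} + x^{2^{t1}} + ⋯` of the function `G`. -/
noncomputable def linearizedFactor (k t1 t2 : ℕ) (x : GaloisField 2 (2 * k)) :
    GaloisField 2 (2 * k) :=
  x + x ^ 2 ^ k + x ^ 2 ^ t1 + x ^ 2 ^ (t1 + k) + x ^ 2 ^ t2 + x ^ 2 ^ (t2 + k)

section LinearizedFactor

variable {k t1 t2 : ℕ}

theorem linearizedFactor_add (x y : GaloisField 2 (2 * k)) :
    linearizedFactor k t1 t2 (x + y) =
      linearizedFactor k t1 t2 x + linearizedFactor k t1 t2 y := by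
  simp only [linearizedFactor, add_pow_two_pow]
  ring

theorem pow_two_pow_twice (hk : k ≠ 0) (x : GaloisField 2 (2 * k)) :
    (x ^ 2 ^ k) ^ 2 ^ k = x := by
  rw [← pow_mul, ← pow_add, ← two_mul, pow_two_pow_self (by lia)]

theorem relTrace_mem (hk : k ≠ 0) (x : GaloisField 2 (2 * k)) :
    (x + x ^ 2 ^ k) ^ 2 ^ k = x + x ^ 2 ^ k := by
  rw [add_pow_two_pow, pow_two_pow_twice hk, add_comm]

theorem linearizedFactor_eq (x : GaloisField 2 (2 * k)) :
    linearizedFactor k t1 t2 x =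
      (x + x ^ 2 ^ k) ^ 2 ^ t1 + (x + x ^ 2 ^ k) ^ 2 ^ t2 + (x + x ^ 2 ^ k) := by
  simp only [linearizedFactor, add_pow_two_pow, ← pow_mul, ← pow_add, add_comm k]
  ring

theorem linearizedFactor_mem (hk : k ≠ 0) (x : GaloisField 2 (2 * k)) :
    linearizedFactor k t1 t2 x ^ 2 ^ k = linearizedFactor k t1 t2 x := by
  simp only [linearizedFactor_eq, add_pow_two_pow _ _ k, pow_right_comm _ (2 ^ t1) (2 ^ k),
    pow_right_comm _ (2 ^ t2) (2 ^ k), pow_two_pow_twice hk]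
  rw [add_comm (x ^ 2 ^ k) x]

theorem linearizedFactor_eq_zero_of_mem {x : GaloisField 2 (2 * k)} (hx : x ^ 2 ^ k = x) :
    linearizedFactor k t1 t2 x = 0 := by
  simp [linearizedFactor_eq, hx, CharTwo.add_self_eq_zero]

theorem pow_eq_self_of_linearizedFactor_eq_zero (hk : k ≠ 0)
    (h : ∀ z : GaloisField 2 (2 * k), z ^ 2 ^ k = z →
      z ^ 2 ^ t1 + z ^ 2 ^ t2 + z = 0 → z = 0)
    {x : GaloisField 2 (2 * k)} (hx : linearizedFactor k t1 t2 x = 0) : x ^ 2 ^ k = x := by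
  rw [linearizedFactor_eq] at hx
  exact (CharTwo.add_eq_zero.mp (h _ (relTrace_mem hk x) hx)).symm

/-- The linearized factor is self-adjoint for the trace form. -/
theorem gTr_mul_linearizedFactor (hk : k ≠ 0) (hsum : t1 + t2 = k)
    (a x : GaloisField 2 (2 * k)) :
    gTr (2 * k) (a * linearizedFactor k t1 t2 x) =
      gTr (2 * k) (linearizedFactor k t1 t2 a * x) := by
  have hn : 2 * k ≠ 0 := by lia
  simp only [linearizedFactor, mul_add, add_mul, gTr_add]
  rw [gTr_mul_pow_two_pow hn a x (j := k) (l := k) (by lia),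
    gTr_mul_pow_two_pow hn a x (j := t1) (l := t2 + k) (by lia),
    gTr_mul_pow_two_pow hn a x (j := t1 + k) (l := t2) (by lia),
    gTr_mul_pow_two_pow hn a x (j := t2) (l := t1 + k) (by lia),
    gTr_mul_pow_two_pow hn a x (j := t2 + k) (l := t1) (by lia)]
  ring

theorem mul_pow_eq_self_iff {a c : GaloisField 2 (2 * k)} (ha : a ^ 2 ^ k ≠ a)
    (hc : c ^ 2 ^ k = c) : (a * c) ^ 2 ^ k = a * c ↔ c = 0 := by
  rw [mul_pow, hc, mul_eq_mul_right_iff, or_iff_right ha]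

/-- The polar form of `x ↦ Tr(α x^{2^i} L(x))` is nondegenerate when `α` lies outside the
subfield. -/
theorem eq_zero_of_polar_eq_zero (hk : k ≠ 0) (i : ℕ) (hsum : t1 + t2 = k)
    (h : ∀ z : GaloisField 2 (2 * k), z ^ 2 ^ k = z →
      z ^ 2 ^ t1 + z ^ 2 ^ t2 + z = 0 → z = 0)
    {α u : GaloisField 2 (2 * k)} (hα : α ^ 2 ^ k ≠ α)
    (hu : ∀ x, gTr (2 * k) (α * (x ^ 2 ^ i * linearizedFactor k t1 t2 u)) +
      gTr (2 * k) (α * (u ^ 2 ^ i * linearizedFactor k t1 t2 x)) = 0) : u = 0 := by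
  have hc : linearizedFactor k t1 t2 u = 0 := by
    set c := linearizedFactor k t1 t2 u with hcdef
    refine (mul_pow_eq_self_iff hα (linearizedFactor_mem hk u)).mp ?_
    rw [← hcdef, ← CharTwo.add_eq_zero]
    refine eq_zero_of_gTr_mul_eq_zero fun z => ?_
    obtain ⟨w, rfl⟩ := exists_pow_two_pow_eq z i
    have hw := hu (w + w ^ 2 ^ k)
    rw [linearizedFactor_eq_zero_of_mem (relTrace_mem hk w), mul_zero, mul_zero,
      gTr_zero, add_zero, add_pow_two_pow,
      pow_right_comm w, show α * ((w ^ 2 ^ i + (w ^ 2 ^ i) ^ 2 ^ k) * c) =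
        α * c * w ^ 2 ^ i + α * c * (w ^ 2 ^ i) ^ 2 ^ k by ring, gTr_add,
      gTr_mul_pow_two_pow (j := k) (l := k) (by lia) _ _ (by lia), ← gTr_add,
      ← add_mul, add_comm] at hw
    exact hw
  have hmem := pow_eq_self_of_linearizedFactor_eq_zero hk h hc
  have hL : linearizedFactor k t1 t2 (α * u ^ 2 ^ i) = 0 := by
    refine eq_zero_of_gTr_mul_eq_zero fun x => ?_
    have hx := hu x
    rw [hc, mul_zero, mul_zero, gTr_zero, zero_add,
      ← mul_assoc, gTr_mul_linearizedFactor hk hsum] at hx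
    exact hx
  have hpow := pow_eq_self_of_linearizedFactor_eq_zero hk h hL
  rw [mul_pow_eq_self_iff hα (by rw [pow_right_comm, hmem])] at hpow
  exact eq_zero_of_pow_eq_zero hpow

end LinearizedFactor

theorem stmt_8 (k : ℕ) (hk : 1 ≤ k) (i t1 t2 : ℕ) (ht1 : 0 < t1) (ht2 : 0 < t2)
    (hsum : t1 + t2 = k)
    (h : ∀ z : GaloisField 2 (2 * k), z ^ 2 ^ k = z →
      z ^ 2 ^ t1 + z ^ 2 ^ t2 + z = 0 → z = 0)
    (α : GaloisField 2 (2 * k)) :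
    IsBent (fun x : GaloisField 2 (2 * k) =>
      gTr (2 * k) (α * (x ^ 2 ^ i *
        (x + x ^ 2 ^ k + x ^ 2 ^ t1 + x ^ 2 ^ (t1 + k) + x ^ 2 ^ t2 + x ^ 2 ^ (t2 + k))))) ↔
      α ^ 2 ^ k ≠ α := by
  have hk0 : k ≠ 0 := by lia
  change IsBent (fun x => gTr (2 * k) (α * (x ^ 2 ^ i * linearizedFactor k t1 t2 x))) ↔ _
  constructor
  · intro hbent hα
    obtain ⟨lam, hlam⟩ : ∃ lam, gTr (2 * k) (1 * lam) ≠ 0 := by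
      by_contra! hall
      exact one_ne_zero (eq_zero_of_gTr_mul_eq_zero hall)
    have hlam1 : gTr (2 * k) lam = 1 := by
      rw [one_mul] at hlam
      exact (show ∀ a : ZMod 2, a ≠ 0 → a = 1 by decide) _ hlam
    have hW := hbent lam
    rw [sum_neg_one_pow_eq_zero_of_translate _ 1] at hW
    · exact absurd hW.symm (by positivity)
    · intro x
      have hlin : gTr (2 * k) (α * linearizedFactor k t1 t2 x) = 0 := by
        rw [gTr_mul_linearizedFactor hk0 hsum, linearizedFactor_eq_zero_of_mem hα,
          zero_mul, gTr_zero]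
      beta_reduce
      rw [linearizedFactor_add, linearizedFactor_eq_zero_of_mem (one_pow _), add_zero,
        add_pow_two_pow, one_pow, add_mul, one_mul, mul_add α, gTr_add, hlin, add_zero,
        mul_add, mul_one, gTr_add, hlam1, add_assoc]
  · intro hα lam
    rw [sq_sum_neg_one_pow_eq_card, ← Nat.card_eq_fintype_card,
      GaloisField.card 2 (2 * k) (by lia)]
    · push_cast
      rfl
    · intro u hu
      obtain ⟨y, hy⟩ : ∃ y, gTr (2 * k) (α * (y ^ 2 ^ i * linearizedFactor k t1 t2 u)) +
          gTr (2 * k) (α * (u ^ 2 ^ i * linearizedFactor k t1 t2 y)) ≠ 0 := by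
        by_contra! hall
        exact hu (eq_zero_of_polar_eq_zero hk0 i hsum h hα hall)
      refine sum_neg_one_pow_eq_zero_of_translate _ y fun x => ?_
      rw [← (show ∀ a : ZMod 2, a ≠ 0 → a = 1 by decide) _ hy]
      simp only [linearizedFactor_add, add_pow_two_pow, mul_add, add_mul, gTr_add]
      ring_nf
      reduce_mod_char
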